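/- arXiv:2507.22364 — 5 statements merged into one kernel-verified Lean document; each statement's English description precedes it below -/
import Mathlib

section
/- Let R be a commutative ring, M an R-module, and x_1, …, x_r ∈ R a sequence of elements with r ≥ 2. Then for every 2 ≤ i ≤ r there is an isomorphism of R-modules ((x_1,…,x_{i-1})M :_M x_i) / ( (x_1,…,x_{i-1})M + ((x_2,…,x_{i-1})M :_M x_i) ) ≅ ((x_2,…,x_i)M :_M x_1) / ( (x_2,…,x_i)M + ((x_2,…,x_{i-1})M :_M x_1) ), where (x_2,…,x_{i-1}) is taken to be the zero ideal when i = 2. -/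
/-!
STATEMENT 11: for an arbitrary sequence `x₁, …, x_r` (indexed here by `x 1, …, x r`
with `x : ℕ → R`) in a commutative ring `R` and any `R`-module `M`, for `2 ≤ i ≤ r`:
`((x₁,…,x_{i-1})M :_M x_i) / ((x₁,…,x_{i-1})M + ((x₂,…,x_{i-1})M :_M x_i))`
  `≅ ((x₂,…,x_i)M :_M x₁) / ((x₂,…,x_i)M + ((x₂,…,x_{i-1})M :_M x₁))`.
A quotient `C/D` (with `D ⊆ C`) is realized as the image of `C` in `M/D`.
-/

open Submodule

theorem mem_sup_colon_aux {R : Type*} [CommRing R] {M : Type*} [AddCommGroup M] [Module R M]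
    (a b : R) (N M1 : Submodule R M) (h1 : ∀ y, y ∈ M1 ↔ ∃ u, y - a • u ∈ N) (m : M) :
    m ∈ M1 ⊔ Submodule.comap (LinearMap.lsmul R M b) N ↔ ∃ u, b • (m - a • u) ∈ N := by
  constructor
  · intro h
    obtain ⟨y, hy, z, hz, rfl⟩ := Submodule.mem_sup.1 h
    obtain ⟨u, hu⟩ := (h1 y).1 hy
    refine ⟨u, ?_⟩
    have hz' : b • z ∈ N := hz
    have := N.add_mem (N.smul_mem b hu) hz'
    convert this using 1
    module
  · rintro ⟨u, hu⟩
    refine Submodule.mem_sup.2 ⟨a • u, (h1 _).2 ⟨u, by simp⟩, m - a • u, hu, by abel⟩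

theorem span_insert_aux {R : Type*} [CommRing R] {M : Type*} [AddCommGroup M] [Module R M]
    (a : R) (S T : Set R) (hT : T = insert a S) (y : M) :
    y ∈ Ideal.span T • (⊤ : Submodule R M) ↔
      ∃ u, y - a • u ∈ Ideal.span S • (⊤ : Submodule R M) := by
  subst hT
  rw [Ideal.span_insert, Submodule.sup_smul, Submodule.mem_sup]
  constructor
  · rintro ⟨p, hp, q, hq, rfl⟩
    rw [Submodule.ideal_span_singleton_smul] at hp
    obtain ⟨u, -, rfl⟩ := (Submodule.mem_smul_pointwise_iff_exists _ _ _).1 hp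
    exact ⟨u, by simpa using hq⟩
  · rintro ⟨u, hu⟩
    exact ⟨a • u, Submodule.smul_mem_smul (Ideal.subset_span rfl) trivial, _, hu, by abel⟩

theorem colon_equiv_aux {R : Type*} [CommRing R] {M : Type*} [AddCommGroup M] [Module R M]
    (a b : R) (M1 N M3 : Submodule R M)
    (h1 : ∀ y, y ∈ M1 ↔ ∃ u, y - a • u ∈ N) (h3 : ∀ y, y ∈ M3 ↔ ∃ u, y - b • u ∈ N) :
    Nonempty
      ((Submodule.map (M1 ⊔ Submodule.comap (LinearMap.lsmul R M b) N).mkQ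
          (Submodule.comap (LinearMap.lsmul R M b) M1))
        ≃ₗ[R]
       (Submodule.map (M3 ⊔ Submodule.comap (LinearMap.lsmul R M a) N).mkQ
          (Submodule.comap (LinearMap.lsmul R M a) M3))) := by
  let P : Submodule R (M × M) :=
    Submodule.comap (b • LinearMap.fst R M M - a • LinearMap.snd R M M) N
  have hP : ∀ p : M × M, p ∈ P ↔ b • p.1 - a • p.2 ∈ N := fun p => Iff.rfl
  let f := (M1 ⊔ Submodule.comap (LinearMap.lsmul R M b) N).mkQ ∘ₗ
    (LinearMap.fst R M M ∘ₗ P.subtype)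
  let g := (M3 ⊔ Submodule.comap (LinearMap.lsmul R M a) N).mkQ ∘ₗ
    (LinearMap.snd R M M ∘ₗ P.subtype)
  have hf : LinearMap.range f = Submodule.map
      (M1 ⊔ Submodule.comap (LinearMap.lsmul R M b) N).mkQ
      (Submodule.comap (LinearMap.lsmul R M b) M1) := by
    rw [LinearMap.range_comp]
    congr 1
    ext m
    constructor
    · rintro ⟨⟨p, hp⟩, rfl⟩
      exact (h1 _).2 ⟨p.2, hp⟩
    · intro hm
      obtain ⟨u, hu⟩ := (h1 _).1 hm
      exact ⟨⟨(m, u), hu⟩, rfl⟩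
  have hg : LinearMap.range g = Submodule.map
      (M3 ⊔ Submodule.comap (LinearMap.lsmul R M a) N).mkQ
      (Submodule.comap (LinearMap.lsmul R M a) M3) := by
    rw [LinearMap.range_comp]
    congr 1
    ext m
    constructor
    · rintro ⟨⟨p, hp⟩, rfl⟩
      refine (h3 _).2 ⟨p.1, ?_⟩
      have := N.neg_mem ((hP p).1 hp)
      rwa [neg_sub] at this
    · intro hm
      obtain ⟨u, hu⟩ := (h3 _).1 hm
      refine ⟨⟨(u, m), (hP _).2 ?_⟩, rfl⟩
      have := N.neg_mem hu
      rwa [neg_sub] at this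
  have hk : LinearMap.ker f = LinearMap.ker g := by
    ext ⟨p, hp⟩
    have hp' := (hP p).1 hp
    have e1 : (⟨p, hp⟩ : P) ∈ LinearMap.ker f ↔ ∃ u, b • (p.1 - a • u) ∈ N := by
      rw [← mem_sup_colon_aux a b N M1 h1, LinearMap.mem_ker]
      exact Submodule.Quotient.mk_eq_zero _
    have e2 : (⟨p, hp⟩ : P) ∈ LinearMap.ker g ↔ ∃ u, a • (p.2 - b • u) ∈ N := by
      rw [← mem_sup_colon_aux b a N M3 h3, LinearMap.mem_ker]
      exact Submodule.Quotient.mk_eq_zero _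
    rw [e1, e2]
    refine exists_congr fun u => ?_
    have e : b • (p.1 - a • u) = (b • p.1 - a • p.2) + a • (p.2 - b • u) := by module
    rw [e]
    exact N.add_mem_iff_right hp'
  exact ⟨(LinearEquiv.ofEq _ _ hf.symm) ≪≫ₗ f.quotKerEquivRange.symm ≪≫ₗ
    (Submodule.quotEquivOfEq _ _ hk) ≪≫ₗ g.quotKerEquivRange ≪≫ₗ (LinearEquiv.ofEq _ _ hg)⟩

theorem stmt11 {R : Type*} [CommRing R] {M : Type*} [AddCommGroup M] [Module R M]
    (r : ℕ) (hr : 2 ≤ r) (x : ℕ → R) (i : ℕ) (hi2 : 2 ≤ i) (hir : i ≤ r)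
    -- `(x₁,…,x_{i-1})M`, `(x₂,…,x_{i-1})M` (the zero submodule when `i = 2`), `(x₂,…,x_i)M`
    (M1 M2 M3 : Submodule R M)
    (hM1 : M1 = (Ideal.span (x '' Set.Icc 1 (i - 1))) • (⊤ : Submodule R M))
    (hM2 : M2 = (Ideal.span (x '' Set.Icc 2 (i - 1))) • (⊤ : Submodule R M))
    (hM3 : M3 = (Ideal.span (x '' Set.Icc 2 i)) • (⊤ : Submodule R M)) :
    Nonempty
      ((Submodule.map (M1 ⊔ Submodule.comap (LinearMap.lsmul R M (x i)) M2).mkQ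
          (Submodule.comap (LinearMap.lsmul R M (x i)) M1))
        ≃ₗ[R]
       (Submodule.map (M3 ⊔ Submodule.comap (LinearMap.lsmul R M (x 1)) M2).mkQ
          (Submodule.comap (LinearMap.lsmul R M (x 1)) M3))) := by
  subst hM1 hM2 hM3
  refine colon_equiv_aux (x 1) (x i) _ _ _ (span_insert_aux _ _ _ ?_) (span_insert_aux _ _ _ ?_)
  · rw [← Set.image_insert_eq]
    congr 1
    ext j
    simp only [Set.mem_Icc, Set.mem_insert_iff]
    omega
  · rw [← Set.image_insert_eq]
    congr 1
    ext j
    simp only [Set.mem_Icc, Set.mem_insert_iff]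
    omega
end

section
/- Let (R, m) be a Noetherian local ring, J an ideal of R, M a finitely generated R-module, and x_1, …, x_r ∈ R a J-filter regular sequence on M with r ≥ 2. For each i = 1, …, r set a_i = a_J( ((x_1,…,x_{i-1})M :_M x_i) / (x_1,…,x_{i-1})M ). Then for every 2 ≤ i ≤ r, the element x_1 is a J-filter regular element on M_i := M/(x_2,…,x_i)M, and a_J( ((x_2,…,x_i)M :_M x_1) / (x_2,…,x_i)M ) ≤ a_1 + a_2 + ⋯ + a_i. -/
open CategoryTheory Submodule IsLocalRing

/-- The `J`-Loewy length `a_J(L) = inf { n | J^n L = 0 }` of a submodule `L`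
(as a natural number; `sInf ∅ = 0`). -/
noncomputable def loewy {R : Type*} [CommRing R] (J : Ideal R) {P : Type*} [AddCommGroup P]
    [Module R P] (L : Submodule R P) : ℕ :=
  sInf {n : ℕ | J ^ n • L = ⊥}

/-- The Artin–Rees number `ar_J(N)` of a submodule `N ⊆ M` with respect to `J`:
the least `c` such that `J^n M ⊓ N = J^(n-c) (J^c M ⊓ N)` for all `n ≥ c`. -/
noncomputable def arNum {R : Type*} [CommRing R] (J : Ideal R) {M : Type*} [AddCommGroup M]
    [Module R M] (N : Submodule R M) : ℕ :=
  sInf {c : ℕ | ∀ n, c ≤ n → (J ^ n • (⊤ : Submodule R M)) ⊓ N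
      = J ^ (n - c) • ((J ^ c • (⊤ : Submodule R M)) ⊓ N)}

theorem aux_iff {R : Type*} [CommRing R] (I : Ideal R) {M : Type*} [AddCommGroup M]
    [Module R M] (N : Submodule R M) (y : R) :
    I • (Submodule.map N.mkQ (Submodule.comap (LinearMap.lsmul R M y) N)) = ⊥ ↔
      ∀ c ∈ I, ∀ m : M, y • m ∈ N → c • m ∈ N := by
  rw [← Submodule.map_smul'', eq_bot_iff, Submodule.map_le_iff_le_comap, Submodule.comap_bot,
    Submodule.ker_mkQ, Submodule.smul_le]
  rfl

theorem aux_insert {R : Type*} [CommRing R] {M : Type*} [AddCommGroup M]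
    [Module R M] (S : Set R) (y : R) (m : M) :
    m ∈ Ideal.span (insert y S) • (⊤ : Submodule R M) ↔
      ∃ v : M, ∃ n ∈ Ideal.span S • (⊤ : Submodule R M), m = y • v + n := by
  rw [Ideal.span_insert, Submodule.sup_smul, Submodule.mem_sup]
  constructor
  · rintro ⟨p, hp, n, hn, rfl⟩
    rw [Submodule.ideal_span_singleton_smul, Submodule.mem_smul_pointwise_iff_exists] at hp
    obtain ⟨v, -, rfl⟩ := hp
    exact ⟨v, n, hn, rfl⟩
  · rintro ⟨v, n, hn, rfl⟩
    exact ⟨y • v, Submodule.smul_mem_smul (Ideal.mem_span_singleton_self y) trivial, n, hn, rfl⟩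

theorem stmt12 {R : Type*} [CommRing R] [IsNoetherianRing R] [IsLocalRing R]
    (J : Ideal R) (M : Type*) [AddCommGroup M] [Module R M] [Module.Finite R M]
    (r : ℕ) (hr : 2 ≤ r) (x : ℕ → R)
    -- `x 1, …, x r` is a `J`-filter regular sequence on `M`:
    -- `a_J( ((x₁,…,x_{i-1})M :_M x_i) / (x₁,…,x_{i-1})M ) < ∞` for `1 ≤ i ≤ r`
    (hfr : ∀ i, 1 ≤ i → i ≤ r →
      ∃ n, J ^ n • (Submodule.map
          ((Ideal.span (x '' Set.Icc 1 (i - 1)) • (⊤ : Submodule R M))).mkQ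
          (Submodule.comap (LinearMap.lsmul R M (x i))
            (Ideal.span (x '' Set.Icc 1 (i - 1)) • (⊤ : Submodule R M)))) = ⊥)
    -- `a i = a_J( ((x₁,…,x_{i-1})M :_M x_i) / (x₁,…,x_{i-1})M )`
    (a : ℕ → ℕ)
    (ha : ∀ i, 1 ≤ i → i ≤ r →
      a i = loewy J (Submodule.map
          ((Ideal.span (x '' Set.Icc 1 (i - 1)) • (⊤ : Submodule R M))).mkQ
          (Submodule.comap (LinearMap.lsmul R M (x i))
            (Ideal.span (x '' Set.Icc 1 (i - 1)) • (⊤ : Submodule R M)))))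
    (i : ℕ) (hi2 : 2 ≤ i) (hir : i ≤ r) :
    -- `x₁` is a `J`-filter regular element on `M_i = M/(x₂,…,x_i)M`, i.e.
    -- `a_J( ((x₂,…,x_i)M :_M x₁) / (x₂,…,x_i)M ) < ∞`, and this Loewy length
    -- is at most `a₁ + a₂ + ⋯ + a_i`
    (∃ n, J ^ n • (Submodule.map
        ((Ideal.span (x '' Set.Icc 2 i) • (⊤ : Submodule R M))).mkQ
        (Submodule.comap (LinearMap.lsmul R M (x 1))
          (Ideal.span (x '' Set.Icc 2 i) • (⊤ : Submodule R M)))) = ⊥)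
    ∧ loewy J (Submodule.map
        ((Ideal.span (x '' Set.Icc 2 i) • (⊤ : Submodule R M))).mkQ
        (Submodule.comap (LinearMap.lsmul R M (x 1))
          (Ideal.span (x '' Set.Icc 2 i) • (⊤ : Submodule R M))))
      ≤ ∑ j ∈ Finset.Icc 1 i, a j := by
  have hA : ∀ i, 1 ≤ i → i ≤ r → ∀ c ∈ J ^ a i, ∀ m : M,
      x i • m ∈ Ideal.span (x '' Set.Icc 1 (i - 1)) • (⊤ : Submodule R M) →
      c • m ∈ Ideal.span (x '' Set.Icc 1 (i - 1)) • (⊤ : Submodule R M) := by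
    intro i h1 h2
    rw [← aux_iff, ha i h1 h2]
    exact Nat.sInf_mem (hfr i h1 h2)
  have key : ∀ i, 1 ≤ i → i ≤ r → ∀ c ∈ J ^ (∑ j ∈ Finset.Icc 1 i, a j), ∀ m : M,
      x 1 • m ∈ Ideal.span (x '' Set.Icc 2 i) • (⊤ : Submodule R M) →
      c • m ∈ Ideal.span (x '' Set.Icc 2 i) • (⊤ : Submodule R M) := by
    intro i h1
    induction i, h1 using Nat.le_induction with
    | base =>
      intro h
      have := hA 1 le_rfl h
      simpa using this
    | succ k hk ih =>
      intro h
      have ih' := ih (by omega)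
      have hk1 := hA (k + 1) (by omega) h
      have e1 : x '' Set.Icc 1 (k + 1 - 1) = insert (x 1) (x '' Set.Icc 2 k) := by
        rw [← Set.image_insert_eq]
        congr 1
        ext t
        simp only [Set.mem_Icc, Set.mem_insert_iff]
        omega
      have e2 : x '' Set.Icc 2 (k + 1) = insert (x (k + 1)) (x '' Set.Icc 2 k) := by
        rw [← Set.image_insert_eq]
        congr 1
        ext t
        simp only [Set.mem_Icc, Set.mem_insert_iff]
        omega
      rw [e1] at hk1
      rw [e2, Finset.sum_Icc_succ_top (by omega), pow_add]
      intro c hc m hm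
      obtain ⟨u, n, hn, hmu⟩ := (aux_insert _ _ _).1 hm
      refine Submodule.mul_induction_on hc ?_ ?_
      · intro d hd c hc
        have hu := hk1 c hc u ((aux_insert _ _ _).2 ⟨m, -n, Submodule.neg_mem _ hn, by
          rw [hmu]; abel⟩)
        obtain ⟨v, n', hn', huv⟩ := (aux_insert _ _ _).1 hu
        have h3 : x 1 • (c • m - x (k + 1) • v) = c • n + x (k + 1) • n' := by
          rw [smul_sub, smul_comm (x 1) c m, hmu, smul_add, smul_comm c (x (k + 1)) u, huv,
            smul_add, smul_comm (x 1) (x (k + 1)) v]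
          abel
        have h4 := ih' d hd (c • m - x (k + 1) • v) (by
          rw [h3]
          exact Submodule.add_mem _ (Submodule.smul_mem _ _ hn) (Submodule.smul_mem _ _ hn'))
        refine (aux_insert _ _ _).2 ⟨d • v, _, h4, ?_⟩
        rw [smul_sub, smul_comm d (x (k + 1)) v, mul_smul]
        abel
      · intro p q hp hq
        rw [add_smul]
        exact Submodule.add_mem _ hp hq
  have hfin := (aux_iff _ _ _).2 (key i (by omega) hir)
  exact ⟨⟨_, hfin⟩, Nat.sInf_le hfin⟩
end

section
/- Let (R, m) be a Noetherian local ring, J an ideal of R, M a finitely generated R-module, and x ∈ R a J-filter regular element on M. Set N = max{ a_J(0 :_M x), ar_J(xM) + 1 }. Then for every ε ∈ J^N, writing x' = x + ε, the submodules xM and x'M have the same initial module in gr_J(M); concretely, for every n ≥ 0 one has (xM ∩ J^n M) + J^{n+1} M = (x'M ∩ J^n M) + J^{n+1} M. -/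
open CategoryTheory Submodule IsLocalRing

theorem stmt14 {R : Type*} [CommRing R] [IsNoetherianRing R] [IsLocalRing R]
    (J : Ideal R) (M : Type*) [AddCommGroup M] [Module R M] [Module.Finite R M]
    (x : R)
    -- `x` is a `J`-filter regular element on `M`, i.e. `a_J(0 :_M x) < ∞`
    (hfr : ∃ n, J ^ n • (LinearMap.ker (LinearMap.lsmul R M x)) = ⊥)
    (N : ℕ)
    (hN : N = max (loewy J (LinearMap.ker (LinearMap.lsmul R M x)))
        (arNum J ((Ideal.span {x} : Ideal R) • (⊤ : Submodule R M)) + 1))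
    (ε : R) (hε : ε ∈ J ^ N) (n : ℕ) :
    -- `xM` and `x'M` have the same initial module in `gr_J(M)`:
    -- `(xM ∩ J^n M) + J^(n+1) M = (x'M ∩ J^n M) + J^(n+1) M` for all `n`
    (((Ideal.span {x} : Ideal R) • (⊤ : Submodule R M)) ⊓ (J ^ n • (⊤ : Submodule R M)))
        ⊔ (J ^ (n + 1) • (⊤ : Submodule R M))
      = (((Ideal.span {x + ε} : Ideal R) • (⊤ : Submodule R M))
            ⊓ (J ^ n • (⊤ : Submodule R M)))
        ⊔ (J ^ (n + 1) • (⊤ : Submodule R M)) := by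
  classical
  set K := LinearMap.ker (LinearMap.lsmul R M x) with hK
  set X := (Ideal.span {x} : Ideal R) • (⊤ : Submodule R M) with hX
  have memspan : ∀ (r : R) (y : M), y ∈ (Ideal.span {r} : Ideal R) • (⊤ : Submodule R M) ↔
      ∃ m, r • m = y := by
    intro r y
    rw [Submodule.ideal_span_singleton_smul, Submodule.mem_smul_pointwise_iff_exists]
    simp
  have hlo : J ^ (loewy J K) • K = ⊥ := Nat.sInf_mem (s := {n : ℕ | J ^ n • K = ⊥}) hfr
  have har : ∀ n, arNum J X ≤ n → (J ^ n • (⊤ : Submodule R M)) ⊓ X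
      = J ^ (n - arNum J X) • ((J ^ (arNum J X) • (⊤ : Submodule R M)) ⊓ X) := by
    refine Nat.sInf_mem (s := {c : ℕ | ∀ n, c ≤ n → (J ^ n • (⊤ : Submodule R M)) ⊓ X
      = J ^ (n - c) • ((J ^ c • (⊤ : Submodule R M)) ⊓ X)}) ?_
    obtain ⟨k, hk⟩ := Ideal.exists_pow_inf_eq_pow_smul J X
    exact ⟨k, fun n hn => hk n hn⟩
  set c := arNum J X with hc
  have hc1 : c + 1 ≤ N := hN ▸ le_max_right _ _
  have hl1 : loewy J K ≤ N := hN ▸ le_max_left _ _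
  have hεK : ∀ m ∈ K, ε • m = 0 := by
    intro m hm
    have : ε • m ∈ J ^ (loewy J K) • K :=
      Submodule.smul_mem_smul (Ideal.pow_le_pow_right hl1 hε) hm
    rwa [hlo, Submodule.mem_bot] at this
  have mono : ∀ {a b : ℕ}, a ≤ b → J ^ b • (⊤ : Submodule R M) ≤ J ^ a • ⊤ :=
    fun h => Submodule.smul_mono_left (Ideal.pow_le_pow_right h)
  have hεk : ∀ (k : ℕ) (m : M), m ∈ J ^ k • (⊤ : Submodule R M) →
      ε • m ∈ J ^ (N + k) • (⊤ : Submodule R M) := by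
    intro k m hm
    rw [pow_add, Submodule.mul_smul]
    exact Submodule.smul_mem_smul hε hm
  have hε0 : ∀ m : M, ε • m ∈ J ^ N • (⊤ : Submodule R M) := fun m =>
    Submodule.smul_mem_smul hε Submodule.mem_top
  have A : ∀ (n : ℕ) (m : M), x • m ∈ J ^ n • (⊤ : Submodule R M) →
      ε • m ∈ J ^ (n + 1) • (⊤ : Submodule R M) := by
    intro n m hm
    rcases le_total n c with h | h
    · exact mono (by omega) (hε0 m)
    · have h1 : x • m ∈ (J ^ n • (⊤ : Submodule R M)) ⊓ X := ⟨hm, (memspan x _).2 ⟨m, rfl⟩⟩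
      rw [har n h] at h1
      have h2 : x • m ∈ J ^ (n - c) • X := Submodule.smul_mono le_rfl inf_le_right h1
      rw [hX, ← Submodule.mul_smul, mul_comm, Submodule.mul_smul,
        Submodule.ideal_span_singleton_smul, Submodule.mem_smul_pointwise_iff_exists] at h2
      obtain ⟨m', hm', he⟩ := h2
      have h3 : ε • (m - m') = 0 := hεK _ (by simp [hK, smul_sub, he])
      rw [smul_sub, sub_eq_zero] at h3
      rw [h3]
      exact mono (by omega) (hεk _ _ hm')
  have B : ∀ (n : ℕ) (m : M), (x + ε) • m ∈ J ^ n • (⊤ : Submodule R M) →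
      ε • m ∈ J ^ (n + 1) • (⊤ : Submodule R M) := by
    intro n
    induction n with
    | zero => exact fun m _ => mono (by omega) (hε0 m)
    | succ k ih =>
      intro m hm
      have h1 := ih m (mono (Nat.le_succ k) hm)
      apply A
      have := Submodule.sub_mem _ hm h1
      rwa [add_smul, add_sub_cancel_right] at this
  apply le_antisymm
  · refine sup_le ?_ le_sup_right
    rintro y ⟨h1, h2⟩
    obtain ⟨m, rfl⟩ := (memspan x y).1 h1
    have h3 := A n m h2
    refine Submodule.mem_sup.2 ⟨(x + ε) • m, ⟨(memspan _ _).2 ⟨m, rfl⟩, ?_⟩, -(ε • m),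
      Submodule.neg_mem _ h3, by rw [add_smul]; abel⟩
    rw [add_smul]
    exact Submodule.add_mem _ h2 (mono (Nat.le_succ n) h3)
  · refine sup_le ?_ le_sup_right
    rintro y ⟨h1, h2⟩
    obtain ⟨m, rfl⟩ := (memspan _ y).1 h1
    have h3 := B n m h2
    refine Submodule.mem_sup.2 ⟨x • m, ⟨(memspan _ _).2 ⟨m, rfl⟩, ?_⟩, ε • m,
      h3, by rw [add_smul]⟩
    have := Submodule.sub_mem _ h2 (mono (Nat.le_succ n) h3)
    rwa [add_smul, add_sub_cancel_right] at this
end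

section
/- Let (R, m) be a Noetherian local ring, J an ideal of R, M a finitely generated R-module, and x_1, x_2 ∈ R a J-filter regular sequence on M. Set a_1 = a_J(0 :_M x_1), a_2 = a_J( (x_1 M :_M x_2) / x_1 M ), and N = max{ a_1 + a_2, ar_J(x_1 M), ar_J((x_1, x_2)M) } + 1. Then for every ε ∈ J^N, writing x_1' = x_1 + ε, the submodules (x_1, x_2)M and (x_1', x_2)M have the same initial module in gr_J(M); concretely, for every n ≥ 0 one has ((x_1,x_2)M ∩ J^n M) + J^{n+1} M = ((x_1',x_2)M ∩ J^n M) + J^{n+1} M. -/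
open CategoryTheory Submodule IsLocalRing

theorem aux_mem_pair {R : Type*} [CommRing R] {M : Type*} [AddCommGroup M] [Module R M]
    (x y : R) (u : M) :
    u ∈ (Ideal.span {x, y} : Ideal R) • (⊤ : Submodule R M) ↔ ∃ a b : M, u = x • a + y • b := by
  rw [Ideal.span_insert, Submodule.sup_smul, Submodule.mem_sup]
  simp only [Submodule.ideal_span_singleton_smul, Submodule.mem_smul_pointwise_iff_exists]
  constructor
  · rintro ⟨_, ⟨a, -, rfl⟩, _, ⟨b, -, rfl⟩, rfl⟩
    exact ⟨a, b, rfl⟩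
  · rintro ⟨a, b, rfl⟩
    exact ⟨_, ⟨a, trivial, rfl⟩, _, ⟨b, trivial, rfl⟩, rfl⟩

theorem aux_loewy {R : Type*} [CommRing R] (J : Ideal R) {P : Type*} [AddCommGroup P]
    [Module R P] (L : Submodule R P) (h : ∃ n, J ^ n • L = ⊥) : J ^ loewy J L • L = ⊥ :=
  Nat.sInf_mem (s := {n : ℕ | J ^ n • L = ⊥}) h

theorem aux_ar {R : Type*} [CommRing R] [IsNoetherianRing R] (J : Ideal R) {M : Type*}
    [AddCommGroup M] [Module R M] [Module.Finite R M] (N : Submodule R M) :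
    ∀ n, arNum J N ≤ n → (J ^ n • (⊤ : Submodule R M)) ⊓ N
      = J ^ (n - arNum J N) • ((J ^ arNum J N • (⊤ : Submodule R M)) ⊓ N) :=
  Nat.sInf_mem (s := {c : ℕ | ∀ n, c ≤ n → (J ^ n • (⊤ : Submodule R M)) ⊓ N
      = J ^ (n - c) • ((J ^ c • (⊤ : Submodule R M)) ⊓ N)}) (by
    obtain ⟨k, hk⟩ := Ideal.exists_pow_inf_eq_pow_smul J N
    exact ⟨k, fun n hn => hk n hn⟩)

theorem aux_ar_pair {R : Type*} [CommRing R] (x y : R) (I : Ideal R) {M : Type*}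
    [AddCommGroup M] [Module R M] (L : Submodule R M) (u : M)
    (hu : u ∈ I • (L ⊓ (Ideal.span {x, y} : Ideal R) • (⊤ : Submodule R M))) :
    ∃ a ∈ I • (⊤ : Submodule R M), ∃ b : M, u = x • a + y • b := by
  induction hu using Submodule.smul_induction_on' with
  | smul r hr v hv =>
    obtain ⟨a, b, rfl⟩ := (aux_mem_pair x y v).1 hv.2
    exact ⟨r • a, Submodule.smul_mem_smul hr trivial, r • b, by
      rw [smul_add, smul_comm r x, smul_comm r y]⟩
  | add v hv w hw h1 h2 =>
    obtain ⟨a, ha, b, rfl⟩ := h1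
    obtain ⟨a', ha', b', rfl⟩ := h2
    exact ⟨a + a', add_mem ha ha', b + b', by simp only [smul_add]; abel⟩

theorem aux_koszul {R : Type*} [CommRing R] (J : Ideal R) {M : Type*}
    [AddCommGroup M] [Module R M] (x₁ x₂ : R) (a₁ a₂ : ℕ)
    (h₁ : J ^ a₁ • (LinearMap.ker (LinearMap.lsmul R M x₁)) = ⊥)
    (h₂ : J ^ a₂ • (Submodule.map
        ((Ideal.span {x₁} • (⊤ : Submodule R M))).mkQ
        (Submodule.comap (LinearMap.lsmul R M x₂)
          (Ideal.span {x₁} • (⊤ : Submodule R M)))) = ⊥)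
    (ε : R) (hε : ε ∈ J ^ a₁ * J ^ a₂) (p q : M) (hpq : x₁ • p + x₂ • q = 0) :
    ∃ w : M, ε • p = x₂ • w := by
  induction hε using Submodule.mul_induction_on' with
  | mem_mul_mem t ht s hs =>
    have hq : s • q ∈ Ideal.span {x₁} • (⊤ : Submodule R M) := by
      rw [← Submodule.Quotient.mk_eq_zero, Submodule.Quotient.mk_smul, ← Submodule.mem_bot R, ← h₂]
      refine Submodule.smul_mem_smul hs ⟨q, ?_, rfl⟩
      show x₂ • q ∈ Ideal.span {x₁} • (⊤ : Submodule R M)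
      rw [Submodule.ideal_span_singleton_smul, Submodule.mem_smul_pointwise_iff_exists]
      exact ⟨-p, trivial, by rw [smul_neg]; exact (eq_neg_of_add_eq_zero_right hpq).symm⟩
    rw [Submodule.ideal_span_singleton_smul, Submodule.mem_smul_pointwise_iff_exists] at hq
    obtain ⟨w, -, hw⟩ := hq
    have hk : s • p + x₂ • w ∈ LinearMap.ker (LinearMap.lsmul R M x₁) := by
      rw [LinearMap.mem_ker]
      show x₁ • (s • p + x₂ • w) = 0
      rw [smul_add, smul_comm x₁ x₂, hw, smul_comm x₁ s, smul_comm x₂ s, ← smul_add, hpq,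
        smul_zero]
    have h0 : t • (s • p + x₂ • w) = 0 := by
      rw [← Submodule.mem_bot R, ← h₁]
      exact Submodule.smul_mem_smul ht hk
    refine ⟨-(t • w), ?_⟩
    rw [smul_add, smul_comm t x₂] at h0
    rw [mul_smul, smul_neg]
    exact eq_neg_of_add_eq_zero_left h0
  | add v hv w hw h1 h2 =>
    obtain ⟨a, ha⟩ := h1
    obtain ⟨b, hb⟩ := h2
    exact ⟨a + b, by rw [add_smul, ha, hb, smul_add]⟩

theorem stmt16 {R : Type*} [CommRing R] [IsNoetherianRing R] [IsLocalRing R]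
    (J : Ideal R) (M : Type*) [AddCommGroup M] [Module R M] [Module.Finite R M]
    (x₁ x₂ : R)
    -- `x₁, x₂` is a `J`-filter regular sequence on `M`
    (hfr₁ : ∃ n, J ^ n • (LinearMap.ker (LinearMap.lsmul R M x₁)) = ⊥)
    (hfr₂ : ∃ n, J ^ n • (Submodule.map
        ((Ideal.span {x₁} • (⊤ : Submodule R M))).mkQ
        (Submodule.comap (LinearMap.lsmul R M x₂)
          (Ideal.span {x₁} • (⊤ : Submodule R M)))) = ⊥)
    -- `a₁ = a_J(0 :_M x₁)`, `a₂ = a_J((x₁M :_M x₂)/x₁M)`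
    (a₁ a₂ : ℕ)
    (ha₁ : a₁ = loewy J (LinearMap.ker (LinearMap.lsmul R M x₁)))
    (ha₂ : a₂ = loewy J (Submodule.map
        ((Ideal.span {x₁} • (⊤ : Submodule R M))).mkQ
        (Submodule.comap (LinearMap.lsmul R M x₂)
          (Ideal.span {x₁} • (⊤ : Submodule R M)))))
    (N : ℕ)
    (hN : N = max (a₁ + a₂)
        (max (arNum J ((Ideal.span {x₁} : Ideal R) • (⊤ : Submodule R M)))
          (arNum J ((Ideal.span {x₁, x₂} : Ideal R) • (⊤ : Submodule R M)))) + 1)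
    (ε : R) (hε : ε ∈ J ^ N) (n : ℕ) :
    -- `(x₁,x₂)M` and `(x₁',x₂)M` have the same initial module in `gr_J(M)`:
    -- `((x₁,x₂)M ∩ J^n M) + J^(n+1) M = ((x₁',x₂)M ∩ J^n M) + J^(n+1) M` for all `n`
    (((Ideal.span {x₁, x₂} : Ideal R) • (⊤ : Submodule R M))
          ⊓ (J ^ n • (⊤ : Submodule R M)))
        ⊔ (J ^ (n + 1) • (⊤ : Submodule R M))
      = (((Ideal.span {x₁ + ε, x₂} : Ideal R) • (⊤ : Submodule R M))
            ⊓ (J ^ n • (⊤ : Submodule R M)))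
        ⊔ (J ^ (n + 1) • (⊤ : Submodule R M)) := by
  have h₁ := ha₁ ▸ aux_loewy J _ hfr₁
  have h₂ := ha₂ ▸ aux_loewy J _ hfr₂
  have har := aux_ar J ((Ideal.span {x₁, x₂} : Ideal R) • (⊤ : Submodule R M))
  set c := arNum J ((Ideal.span {x₁, x₂} : Ideal R) • (⊤ : Submodule R M)) with hc
  have hNa : a₁ + a₂ ≤ N := by omega
  have hNc : c + 1 ≤ N := by omega
  clear_value c
  have hmono : ∀ {k l : ℕ}, k ≤ l → ∀ {v : M}, v ∈ J ^ l • (⊤ : Submodule R M) →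
      v ∈ J ^ k • (⊤ : Submodule R M) := fun h _ hv =>
    Submodule.smul_mono_left (Ideal.pow_le_pow_right h) hv
  have hεa : ∀ a : M, ε • a ∈ J ^ N • (⊤ : Submodule R M) := fun a =>
    Submodule.smul_mem_smul hε trivial
  have hεk : ∀ k, c ≤ k → ∀ a ∈ J ^ (k - c) • (⊤ : Submodule R M),
      ε • a ∈ J ^ (k + 1) • (⊤ : Submodule R M) := by
    intro k hk a ha
    refine hmono (l := N + (k - c)) (by omega) ?_
    rw [pow_add, ← smul_eq_mul, Submodule.smul_assoc]
    exact Submodule.smul_mem_smul hε ha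
  -- elements of `(x₁,x₂)M ∩ J^k M` have representations with small coefficient of `x₁`
  have hrep : ∀ k, N ≤ k + 1 → ∀ u ∈ (Ideal.span {x₁, x₂} : Ideal R) • (⊤ : Submodule R M),
      u ∈ J ^ k • (⊤ : Submodule R M) → ∃ a b : M, u = x₁ • a + x₂ • b ∧
        ε • a ∈ J ^ (k + 1) • (⊤ : Submodule R M) := by
    intro k hk u hu hu'
    have h : u ∈ (J ^ k • (⊤ : Submodule R M)) ⊓
      ((Ideal.span {x₁, x₂} : Ideal R) • (⊤ : Submodule R M)) := ⟨hu', hu⟩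
    rw [har k (by omega)] at h
    obtain ⟨a, ha, b, hab⟩ := aux_ar_pair _ _ _ _ _ h
    exact ⟨a, b, hab, hεk k (by omega) a ha⟩
  have hkos : ∀ p q : M, x₁ • p + x₂ • q = 0 → ∃ w : M, ε • p = x₂ • w := fun p q =>
    aux_koszul J x₁ x₂ a₁ a₂ h₁ h₂ ε (by rw [← pow_add]; exact Ideal.pow_le_pow_right hNa hε) p q
  apply le_antisymm
  · refine sup_le ?_ le_sup_right
    rintro u ⟨hu, hun⟩
    have : ∃ a b : M, u = x₁ • a + x₂ • b ∧ ε • a ∈ J ^ (n + 1) • (⊤ : Submodule R M) := by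
      by_cases hn : N ≤ n + 1
      · exact hrep n hn u hu hun
      · obtain ⟨a, b, h⟩ := (aux_mem_pair _ _ _).1 hu
        exact ⟨a, b, h, hmono (by omega) (hεa a)⟩
    obtain ⟨a, b, h, ha⟩ := this
    refine Submodule.mem_sup.2 ⟨u + ε • a, ⟨(aux_mem_pair _ _ _).2 ⟨a, b, ?_⟩,
      add_mem hun (hmono (Nat.le_succ n) ha)⟩, -(ε • a), neg_mem ha, by abel⟩
    rw [h, add_smul]; abel
  · refine sup_le ?_ le_sup_right
    rintro u ⟨hu, hun⟩
    obtain ⟨a, b, h⟩ := (aux_mem_pair _ _ _).1 hu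
    have key : ∀ k, k ≤ n + 1 → ∃ b' : M,
        u - (x₁ • a + x₂ • b') ∈ J ^ k • (⊤ : Submodule R M) := by
      intro k
      induction k with
      | zero => intro _; exact ⟨0, by simp⟩
      | succ k ih =>
        intro hk
        by_cases hkN : k + 1 ≤ N
        · refine ⟨b, hmono hkN ?_⟩
          have : u - (x₁ • a + x₂ • b) = ε • a := by rw [h, add_smul]; abel
          rw [this]; exact hεa a
        · obtain ⟨b', hb'⟩ := ih (by omega)
          have hm : x₁ • a + x₂ • b' ∈ J ^ k • (⊤ : Submodule R M) := by
            have := sub_mem (hmono (show k ≤ n by omega) hun) hb'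
            rwa [sub_sub_cancel] at this
          obtain ⟨a'', b'', h'', ha''⟩ := hrep k (by omega) _
            ((aux_mem_pair _ _ _).2 ⟨a, b', rfl⟩) hm
          obtain ⟨w, hw⟩ := hkos (a - a'') (b' - b'') (by
            rw [smul_sub, smul_sub, ← sub_eq_zero.2 h'']; abel)
          refine ⟨b + w, ?_⟩
          have : u - (x₁ • a + x₂ • (b + w)) = ε • a'' := by
            rw [h, smul_add, ← hw, add_smul, smul_sub]; abel
          rw [this]; exact ha''
    obtain ⟨b', hb'⟩ := key (n + 1) le_rfl
    refine Submodule.mem_sup.2 ⟨x₁ • a + x₂ • b', ⟨(aux_mem_pair _ _ _).2 ⟨a, b', rfl⟩, ?_⟩,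
      _, hb', by abel⟩
    have := sub_mem hun (hmono (Nat.le_succ n) hb')
    rwa [sub_sub_cancel] at this
end

section
/- Let (R, m) be a Noetherian local ring, J an ideal of R, and M a finitely generated R-module. Let K ⊆ N be submodules of M, and let N̄ = N/K denote the image of N in M/K. Then ar_J(N̄) ≤ ar_J(N), where on the left the Artin–Rees number is computed for the submodule N̄ of the module M/K. -/
open Submodule

theorem stmt17 {R : Type*} [CommRing R] [IsNoetherianRing R] [IsLocalRing R]
    (J : Ideal R) (M : Type*) [AddCommGroup M] [Module R M] [Module.Finite R M]
    (K N : Submodule R M) (hKN : K ≤ N) :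
    -- `ar_J(N/K) ≤ ar_J(N)`, the left-hand side computed for `N/K ⊆ M/K`
    arNum J (Submodule.map K.mkQ N) ≤ arNum J N := by
  have hmap : ∀ n, (J ^ n • (⊤ : Submodule R (M ⧸ K))) ⊓ Submodule.map K.mkQ N
      = Submodule.map K.mkQ ((J ^ n • (⊤ : Submodule R M)) ⊓ N) := by
    intro n
    have h1 : (J ^ n • (⊤ : Submodule R (M ⧸ K)))
        = Submodule.map K.mkQ (J ^ n • (⊤ : Submodule R M)) := by
      rw [Submodule.map_smul'', Submodule.map_top, Submodule.range_mkQ]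
    rw [h1]
    apply le_antisymm
    · rintro _ ⟨⟨a, ha, rfl⟩, ⟨b, hb, hab⟩⟩
      refine ⟨a, ⟨ha, ?_⟩, rfl⟩
      have h2 : b - a ∈ K := (Submodule.Quotient.eq K).1 hab
      have h3 := N.sub_mem hb (hKN h2)
      simpa using h3
    · exact Submodule.map_inf_le _
  have hne : {c : ℕ | ∀ n, c ≤ n → (J ^ n • (⊤ : Submodule R M)) ⊓ N
      = J ^ (n - c) • ((J ^ c • (⊤ : Submodule R M)) ⊓ N)}.Nonempty := by
    obtain ⟨k, hk⟩ := Ideal.exists_pow_inf_eq_pow_smul J N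
    exact ⟨k, fun n hn => hk n hn⟩
  have hc := Nat.sInf_mem hne
  unfold arNum
  apply Nat.sInf_le
  intro n hn
  rw [hmap, hmap, ← Submodule.map_smul'', ← hc n hn]
end
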